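/- arXiv:2603.15073 — 9 statements merged into one kernel-verified Lean document; each statement's English description precedes it below -/
import Mathlib

section
/- The map g preserves the interval [0, b]: for every x ∈ [0, b], g(x) ∈ [0, b], where b is the unique positive root of g. -/
noncomputable def g (x : ℝ) : ℝ :=
  (5/2) * x - x ^ 2 / 10 - x ^ 3 / 50 - x ^ 4 / 2000

lemma g_eq_mul (x : ℝ) :
    g x = x * (5 / 2 - x / 10 - x ^ 2 / 50 - x ^ 3 / 2000) := by
  unfold g
  ring

/-- The maximum of `g` on the nonnegative half-line is about `7.22`. -/
lemma g_le_eight {x : ℝ} (hx : 0 ≤ x) : g x ≤ 8 := by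
  unfold g
  nlinarith [sq_nonneg (x - 19 / 4), mul_nonneg hx (sq_nonneg (x - 19 / 4)),
    sq_nonneg (x ^ 2 - (19 / 4) ^ 2)]

/-- The positive root of `g` is about `8.31`. -/
lemma eight_le_of_g_eq_zero {b : ℝ} (hb : 0 < b) (hroot : g b = 0) : 8 ≤ b := by
  rw [g_eq_mul] at hroot
  have hfac := (mul_eq_zero.mp hroot).resolve_left hb.ne'
  by_contra! hlt
  have hsq : b ^ 2 ≤ 8 ^ 2 := by gcongr
  have hcube : b ^ 3 ≤ 8 ^ 3 := by gcongr
  linarith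

lemma g_nonneg_of_le_root {b x : ℝ} (hb : 0 < b) (hroot : g b = 0) (hx : 0 ≤ x)
    (hxb : x ≤ b) : 0 ≤ g x := by
  rw [g_eq_mul] at hroot ⊢
  have hfac := (mul_eq_zero.mp hroot).resolve_left hb.ne'
  have hsq : x ^ 2 ≤ b ^ 2 := by gcongr
  have hcube : x ^ 3 ≤ b ^ 3 := by gcongr
  exact mul_nonneg hx (by linarith)

theorem g_preserves_interval (b : ℝ) (hb_pos : 0 < b) (hb_root : g b = 0)
    (hb_unique : ∀ y : ℝ, 0 < y → g y = 0 → y = b) :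
    ∀ x ∈ Set.Icc (0 : ℝ) b, g x ∈ Set.Icc (0 : ℝ) b := by
  rintro x ⟨hx, hxb⟩
  exact ⟨g_nonneg_of_le_root hb_pos hb_root hx hxb,
    (g_le_eight hx).trans (eight_le_of_g_eq_zero hb_pos hb_root)⟩
end

section
/- The Heun map F is not injective (hence not a diffeomorphism): the point (0, b), where b is the unique positive root of g, is a non-local pre-image of the origin, i.e. F(0, b) = (0, 0) = F(0, 0) while (0, b) ≠ (0, 0). -/
noncomputable def f (x : ℝ × ℝ) : ℝ × ℝ :=
  (-2 * x.1 - x.1 ^ 2 / (1 + x.2 ^ 4), -30 * x.2 - x.2 ^ 2 / (1 + x.1 ^ 4))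

noncomputable def F (x : ℝ × ℝ) : ℝ × ℝ :=
  x + (((1 : ℝ)/10) / 2) • (f x + f (x + ((1 : ℝ)/10) • f x))

/-- On the second axis, `F` preserves the axis and acts there as `g`. -/
theorem F_zero_left (x : ℝ) : F (0, x) = (0, g x) := by
  ext
  · simp [F, f]
  · simp [F, f, g]
    ring

theorem F_not_injective (b : ℝ) (hb_pos : 0 < b) (hb_root : g b = 0)
    (hb_unique : ∀ y : ℝ, 0 < y → g y = 0 → y = b) :
    F (0, b) = (0, 0) ∧ F (0, 0) = (0, 0) ∧ ((0 : ℝ), b) ≠ ((0 : ℝ), (0 : ℝ)) ∧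
    ¬ Function.Injective F := by
  have hFb : F (0, b) = (0, 0) := by rw [F_zero_left, hb_root]
  have hF0 : F (0, 0) = (0, 0) := by simp [F_zero_left, g]
  have hne : ((0 : ℝ), b) ≠ ((0 : ℝ), (0 : ℝ)) := by simpa using hb_pos.ne'
  exact ⟨hFb, hF0, hne, fun hinj => hne (hinj (hFb.trans hF0.symm))⟩
end

section
/- The origin is a hyperbolic fixed point of the Heun map F: F(0,0) = (0,0), F is differentiable at (0,0), and its Fréchet derivative at (0,0) is the diagonal linear map (u, v) ↦ ((41/50)·u, (5/2)·v), whose eigenvalues satisfy 41/50 < 1 < 5/2 (one inside and one outside the unit circle). -/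
/-- A square of a function vanishing at `a`, divided by `1 + w ^ 4`, has zero derivative at `a`. -/
theorem hasFDerivAt_sq_div_one_add_pow_four {E : Type*} [NormedAddCommGroup E] [NormedSpace ℝ E]
    {u w : E → ℝ} {a : E} (hu : DifferentiableAt ℝ u a) (hw : DifferentiableAt ℝ w a)
    (h0 : u a = 0) :
    HasFDerivAt (fun x => u x ^ 2 / (1 + w x ^ 4)) (0 : E →L[ℝ] ℝ) a := by
  have hne : 1 + w a ^ 4 ≠ 0 := by positivity
  have hc : DifferentiableAt ℝ (fun x => (1 + w x ^ 4)⁻¹) a :=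
    ((hw.pow 4).const_add 1).inv hne
  have h := (hu.hasFDerivAt.pow 2).mul hc.hasFDerivAt
  simp only [div_eq_mul_inv]
  refine h.congr_fderiv ?_
  simp [h0]

theorem f_zero : f 0 = 0 := by
  ext <;> simp [f]

theorem hasFDerivAt_f_zero :
    HasFDerivAt f
      (((-2 : ℝ) • ContinuousLinearMap.fst ℝ ℝ ℝ).prod
        ((-30 : ℝ) • ContinuousLinearMap.snd ℝ ℝ ℝ)) 0 := by
  have h1 := (hasFDerivAt_fst (𝕜 := ℝ) (p := (0 : ℝ × ℝ))).const_mul (-2)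
  have h2 := (hasFDerivAt_snd (𝕜 := ℝ) (p := (0 : ℝ × ℝ))).const_mul (-30)
  have q1 := hasFDerivAt_sq_div_one_add_pow_four (a := (0 : ℝ × ℝ))
    differentiableAt_fst differentiableAt_snd rfl
  have q2 := hasFDerivAt_sq_div_one_add_pow_four (a := (0 : ℝ × ℝ))
    differentiableAt_snd differentiableAt_fst rfl
  have h := (h1.sub q1).prodMk (h2.sub q2)
  rw [sub_zero, sub_zero] at h
  exact h

theorem origin_hyperbolic_fixed_point :
    F (0, 0) = (0, 0) ∧
    ∃ L : ℝ × ℝ →L[ℝ] ℝ × ℝ, HasFDerivAt F L ((0 : ℝ), (0 : ℝ)) ∧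
      (∀ u v : ℝ, L (u, v) = ((41/50) * u, (5/2) * v)) ∧
      (41/50 : ℝ) < 1 ∧ (1 : ℝ) < 5/2 := by
  refine ⟨by ext <;> simp [F, f], ?_⟩
  have hf := hasFDerivAt_f_zero
  have hstep := (hasFDerivAt_id (𝕜 := ℝ) (0 : ℝ × ℝ)).add (hf.const_smul ((1 : ℝ) / 10))
  have hcomp := HasFDerivAt.comp (0 : ℝ × ℝ) (g := f) (by simpa [f_zero] using hf) hstep
  refine ⟨_, (hasFDerivAt_id (𝕜 := ℝ) (0 : ℝ × ℝ)).add
    ((hf.add hcomp).const_smul (((1 : ℝ) / 10) / 2)), fun u v => ?_, by norm_num, by norm_num⟩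
  ext <;> simp <;> ring
end

section
/- For every x₁ ∈ [0, 1] and every x₂ ∈ ℝ, the first component of F(x₁, x₂) satisfies 0 ≤ (F(x₁, x₂))₁ ≤ (83/100)·x₁. -/
theorem F_first_component_contracts :
    ∀ x₁ ∈ Set.Icc (0 : ℝ) 1, ∀ x₂ : ℝ,
      0 ≤ (F (x₁, x₂)).1 ∧ (F (x₁, x₂)).1 ≤ (83/100) * x₁ := by
  rintro x ⟨hx0, hx1⟩ x₂
  have inv_bounds (t : ℝ) : 0 ≤ (1 + t ^ 4)⁻¹ ∧ (1 + t ^ 4)⁻¹ ≤ 1 := by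
    have ht : 0 ≤ t ^ 4 := by positivity
    exact ⟨by positivity, inv_le_one_of_one_le₀ (by linarith)⟩
  simp only [F, f, Prod.fst_add, Prod.snd_add, Prod.smul_fst, Prod.smul_snd, smul_eq_mul,
    div_eq_mul_inv (_ ^ 2)]
  obtain ⟨ha0, ha1⟩ := inv_bounds x₂
  generalize (1 + x₂ ^ 4)⁻¹ = a at *
  generalize x₂ + _ = y₂
  obtain ⟨hb0, hb1⟩ := inv_bounds y₂
  generalize (1 + y₂ ^ 4)⁻¹ = b at *
  have hax0 : 0 ≤ x ^ 2 * a := by positivity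
  have hxx : x ^ 2 ≤ x := by nlinarith
  have hax : x ^ 2 * a ≤ x := by nlinarith [sq_nonneg x]
  obtain ⟨y, hy⟩ : ∃ y, y = x + 1 / 10 * (-2 * x - x ^ 2 * a) := ⟨_, rfl⟩
  rw [← hy]
  have hy0 : 0 ≤ y := by linarith
  have hyx : y ≤ x := by linarith
  have hby0 : 0 ≤ y ^ 2 * b := by positivity
  have hby : y ^ 2 * b ≤ x := by nlinarith [sq_nonneg y]
  constructor <;> linarith
end

section
/- Trajectories converge exponentially to the x₂-axis: for every x₁ ∈ [0, 1], every x₂ ∈ ℝ, and every n ∈ ℕ, the first component of the n-th iterate satisfies 0 ≤ (Fⁿ(x₁, x₂))₁ ≤ (83/100)ⁿ · x₁. -/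
/-- One Heun step maps `x₁ ∈ [0, 1]` into `[0, (83/100) x₁]`. -/
theorem F_fst_mem_Icc {x : ℝ × ℝ} (hx : x.1 ∈ Set.Icc (0 : ℝ) 1) :
    (F x).1 ∈ Set.Icc 0 (83 / 100 * x.1) := by
  have inv_mem (t : ℝ) : 0 ≤ (1 + t ^ 4)⁻¹ ∧ (1 + t ^ 4)⁻¹ ≤ 1 :=
    ⟨by positivity, inv_le_one_of_one_le₀ (le_add_of_nonneg_right (by positivity))⟩
  obtain ⟨hx0, hx1⟩ := hx
  obtain ⟨ha0, ha1⟩ := inv_mem x.2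
  obtain ⟨hb0, hb1⟩ := inv_mem (x + ((1 : ℝ) / 10) • f x).2
  set a := (1 + x.2 ^ 4)⁻¹ with ha
  set b := (1 + (x + ((1 : ℝ) / 10) • f x).2 ^ 4)⁻¹ with hb
  set y := (x + ((1 : ℝ) / 10) • f x).1 with hy
  have hy_eq : y = 4 / 5 * x.1 - 1 / 10 * (x.1 ^ 2 * a) := by
    simp only [hy, ha, f, Prod.fst_add, Prod.smul_fst, smul_eq_mul, div_eq_mul_inv]
    ring
  have hF : (F x).1 = 41 / 50 * x.1 - 1 / 25 * (x.1 ^ 2 * a) - 1 / 20 * (y ^ 2 * b) := by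
    have : (F x).1 = x.1 + 1 / 20 * ((-2 * x.1 - x.1 ^ 2 * a) + (-2 * y - y ^ 2 * b)) := by
      simp only [F, Prod.fst_add, Prod.smul_fst, smul_eq_mul]
      rw [show (f x).1 = -2 * x.1 - x.1 ^ 2 * a from rfl,
        show (f (x + ((1 : ℝ) / 10) • f x)).1 = -2 * y - y ^ 2 * b from rfl]
      ring
    rw [this]
    linarith
  have hxx : x.1 ^ 2 ≤ x.1 := by nlinarith
  have hxa0 : 0 ≤ x.1 ^ 2 * a := by positivity
  have hxa : x.1 ^ 2 * a ≤ x.1 := (mul_le_of_le_one_right (sq_nonneg _) ha1).trans hxx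
  have hy0 : 0 ≤ y := by linarith
  have hyx : y ≤ x.1 := by linarith
  have hyb0 : 0 ≤ y ^ 2 * b := by positivity
  have hyb : y ^ 2 * b ≤ x.1 :=
    (mul_le_of_le_one_right (sq_nonneg _) hb1).trans ((pow_le_pow_left₀ hy0 hyx 2).trans hxx)
  constructor <;> linarith

theorem iterates_converge_to_x2_axis :
    ∀ x₁ ∈ Set.Icc (0 : ℝ) 1, ∀ x₂ : ℝ, ∀ n : ℕ,
      0 ≤ (F^[n] (x₁, x₂)).1 ∧ (F^[n] (x₁, x₂)).1 ≤ (83/100) ^ n * x₁ := by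
  intro x₁ hx x₂ n
  induction n with
  | zero => simpa using hx.1
  | succ n ih =>
    obtain ⟨h0, h1⟩ := ih
    have hle : (83 / 100 : ℝ) ^ n * x₁ ≤ 1 :=
      mul_le_one₀ (pow_le_one₀ (by norm_num) (by norm_num)) hx.1 hx.2
    obtain ⟨hF0, hF1⟩ := F_fst_mem_Icc ⟨h0, h1.trans hle⟩
    rw [Function.iterate_succ_apply', pow_succ]
    exact ⟨hF0, by linarith⟩
end

section
/- The x₁-axis is invariant under F (the second component of F(x₁, 0) is 0 for every x₁ ∈ ℝ), and the segment of the x₁-axis with x₁ ∈ [0, 1] lies in the stable set of the origin: for every x₁ ∈ [0, 1], the iterates Fⁿ(x₁, 0) converge to (0, 0) as n → ∞. -/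
theorem F_axis (t : ℝ) :
    F (t, 0) = (t - (1 / 20) * (2 * t + t ^ 2
      + 2 * (4 / 5 * t - t ^ 2 / 10) + (4 / 5 * t - t ^ 2 / 10) ^ 2), 0) := by
  ext
  · simp [F, f]
    ring
  · simp [F, f]

theorem F_axis_contracts {t : ℝ} (ht : t ∈ Set.Icc (0 : ℝ) 1) :
    0 ≤ (F (t, 0)).1 ∧ (F (t, 0)).1 ≤ 9 / 10 * t := by
  obtain ⟨h0, h1⟩ := ht
  have hsq : t ^ 2 ≤ t := by nlinarith
  have hy0 : 0 ≤ 4 / 5 * t - t ^ 2 / 10 := by linarith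
  have hy1 : 4 / 5 * t - t ^ 2 / 10 ≤ 1 := by nlinarith
  rw [F_axis]
  constructor <;> nlinarith [mul_nonneg hy0 (sub_nonneg.2 hy1), sq_nonneg t]

theorem F_iterate_axis {t : ℝ} (ht : t ∈ Set.Icc (0 : ℝ) 1) (n : ℕ) :
    ∃ u : ℝ, F^[n] (t, 0) = (u, 0) ∧ 0 ≤ u ∧ u ≤ (9 / 10) ^ n := by
  induction n with
  | zero => exact ⟨t, rfl, ht.1, by simpa using ht.2⟩
  | succ n ih =>
    obtain ⟨u, hu, h0, hn⟩ := ih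
    have h1 : u ≤ 1 := hn.trans (pow_le_one₀ (by norm_num) (by norm_num))
    obtain ⟨hF0, hF1⟩ := F_axis_contracts ⟨h0, h1⟩
    refine ⟨(F (u, 0)).1, ?_, hF0, ?_⟩
    · rw [Function.iterate_succ_apply', hu, F_axis]
    · rw [pow_succ]
      linarith

theorem x1_axis_invariant_and_stable :
    (∀ x₁ : ℝ, (F (x₁, 0)).2 = 0) ∧
    ∀ x₁ ∈ Set.Icc (0 : ℝ) 1,
      Filter.Tendsto (fun n : ℕ => F^[n] (x₁, 0)) Filter.atTop
        (nhds ((0 : ℝ), (0 : ℝ))) := by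
  refine ⟨fun t => by rw [F_axis], fun t ht => ?_⟩
  choose u hu h0 hn using F_iterate_axis ht
  simp only [hu]
  have hpow : Filter.Tendsto (fun n : ℕ => (9 / 10 : ℝ) ^ n) Filter.atTop (nhds 0) :=
    tendsto_pow_atTop_nhds_zero_of_lt_one (by norm_num) (by norm_num)
  exact (squeeze_zero h0 hn hpow).prodMk_nhds tendsto_const_nhds
end

section
/- The map g has a periodic point of minimal period 4: there exists p ∈ ℝ with |p − 4.613677692731402| < 1/10 such that g⁴(p) = p, the four points p, g(p), g²(p), g³(p) are pairwise distinct, and moreover |g(p) − 7.214907799688287| < 1/10, |g²(p) − 3.9654987245283035| < 1/10, |g³(p) − 6.9704245174643379| < 1/10. -/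
theorem continuous_g : Continuous g := by
  unfold g
  fun_prop

theorem monotoneOn_g : MonotoneOn g (Set.Icc 0 4.7) := by
  rintro u ⟨hu, hu'⟩ v ⟨hv, hv'⟩ huv
  have slope : 0 ≤ 5 / 2 - (u + v) / 10 - (u ^ 2 + u * v + v ^ 2) / 50
      - (u + v) * (u ^ 2 + v ^ 2) / 2000 := by
    have huu : u ^ 2 ≤ 4.7 ^ 2 := by gcongr
    have hvv : v ^ 2 ≤ 4.7 ^ 2 := by gcongr
    have huv' : u * v ≤ 4.7 * 4.7 := by gcongr
    have hc : (u + v) * (u ^ 2 + v ^ 2) ≤ (4.7 + 4.7) * (4.7 ^ 2 + 4.7 ^ 2) := by gcongr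
    norm_num at *
    linarith
  have := mul_nonneg (sub_nonneg.2 huv) slope
  unfold g
  linarith

theorem antitoneOn_g : AntitoneOn g (Set.Ici 5) := by
  intro u hu v hv huv
  rw [Set.mem_Ici] at hu hv
  have slope : 0 ≤ -(5 / 2) + (u + v) / 10 + (u ^ 2 + u * v + v ^ 2) / 50
      + (u + v) * (u ^ 2 + v ^ 2) / 2000 := by
    have huu : 5 ^ 2 ≤ u ^ 2 := by gcongr
    have hvv : 5 ^ 2 ≤ v ^ 2 := by gcongr
    have huv' : 5 * 5 ≤ u * v := by gcongr
    have hc : 0 ≤ (u + v) * (u ^ 2 + v ^ 2) := by positivity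
    linarith
  have := mul_nonneg (sub_nonneg.2 huv) slope
  unfold g
  linarith

theorem g_has_period_four_point :
    ∃ p : ℝ, |p - 4.613677692731402| < 1/10 ∧ g^[4] p = p ∧
      (p ≠ g p ∧ p ≠ g^[2] p ∧ p ≠ g^[3] p ∧
       g p ≠ g^[2] p ∧ g p ≠ g^[3] p ∧ g^[2] p ≠ g^[3] p) ∧
      |g p - 7.214907799688287| < 1/10 ∧
      |g^[2] p - 3.9654987245283035| < 1/10 ∧
      |g^[3] p - 6.9704245174643379| < 1/10 := by
  obtain ⟨p, ⟨hp₁, hp₂⟩, hp⟩ : ∃ p ∈ Set.Icc (4.6 : ℝ) 4.62, g^[4] p - p = 0 := by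
    refine intermediate_value_Icc' (f := fun x => g^[4] x - x) (by norm_num)
      ((continuous_g.iterate 4).sub continuous_id).continuousOn ⟨?_, ?_⟩ <;>
    · simp only [Function.iterate_succ, Function.iterate_zero, Function.comp_apply, id, g]
      norm_num
  obtain ⟨h1₁, h1₂⟩ : g p ∈ Set.Icc (7.21 : ℝ) 7.22 :=
    Set.Icc_subset_Icc (by norm_num [g]) (by norm_num [g])
      ((monotoneOn_g.mono (Set.Icc_subset_Icc (by norm_num) (by norm_num))).mapsTo_Icc ⟨hp₁, hp₂⟩)
  obtain ⟨h2₁, h2₂⟩ : g (g p) ∈ Set.Icc (3.95 : ℝ) 3.98 :=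
    Set.Icc_subset_Icc (by norm_num [g]) (by norm_num [g])
      ((antitoneOn_g.mono (Set.Icc_subset_Ici_self.trans (Set.Ici_subset_Ici.2 (by norm_num)))).mapsTo_Icc
        ⟨h1₁, h1₂⟩)
  obtain ⟨h3₁, h3₂⟩ : g (g (g p)) ∈ Set.Icc (6.95 : ℝ) 6.99 :=
    Set.Icc_subset_Icc (by norm_num [g]) (by norm_num [g])
      ((monotoneOn_g.mono (Set.Icc_subset_Icc (by norm_num) (by norm_num))).mapsTo_Icc ⟨h2₁, h2₂⟩)
  have hp' := sub_eq_zero.1 hp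
  norm_num at hp₁ hp₂ h1₁ h1₂ h2₁ h2₂ h3₁ h3₂
  refine ⟨p, ?_, hp', ⟨?_, ?_, ?_, ?_, ?_, ?_⟩, ?_, ?_, ?_⟩ <;>
  (try simp only [Function.iterate_succ, Function.iterate_zero, Function.comp_apply, id, abs_lt]) <;>
  first
  | (intro h; linarith)
  | (constructor <;> norm_num <;> linarith)
end

section
/- The map g has negative Schwarzian derivative on [0, ∞): for every x ≥ 0 with g'(x) ≠ 0, one has g'''(x)/g'(x) − (3/2)·(g''(x)/g'(x))² < 0. -/
theorem deriv_g : deriv g = fun x => 5/2 - x / 5 - 3 * x ^ 2 / 50 - x ^ 3 / 500 := by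
  funext x
  have h := ((((hasDerivAt_id x).const_mul (5/2)).sub ((hasDerivAt_pow 2 x).div_const 10)).sub
    ((hasDerivAt_pow 3 x).div_const 50)).sub ((hasDerivAt_pow 4 x).div_const 2000)
  refine (HasDerivAt.deriv (f := g) h).trans ?_
  norm_num
  ring

theorem deriv_deriv_g : deriv (deriv g) = fun x => -1/5 - 3 * x / 25 - 3 * x ^ 2 / 500 := by
  rw [deriv_g]
  funext x
  have h := ((((hasDerivAt_id x).div_const 5).const_sub (5/2)).sub
    (((hasDerivAt_pow 2 x).const_mul 3).div_const 50)).sub ((hasDerivAt_pow 3 x).div_const 500)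
  refine (HasDerivAt.deriv h).trans ?_
  norm_num
  ring

theorem deriv_deriv_deriv_g : deriv (deriv (deriv g)) = fun x => -3/25 - 3 * x / 250 := by
  rw [deriv_deriv_g]
  funext x
  have h := ((((hasDerivAt_id x).const_mul 3).div_const 25).const_sub (-1/5)).sub
    (((hasDerivAt_pow 2 x).const_mul 3).div_const 500)
  refine (HasDerivAt.deriv h).trans ?_
  norm_num
  ring

theorem g_negative_schwarzian :
    ∀ x : ℝ, 0 ≤ x → deriv g x ≠ 0 →
      deriv (deriv (deriv g)) x / deriv g x -
        (3/2) * (deriv (deriv g) x / deriv g x) ^ 2 < 0 := by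
  intro x hx hg
  have schwarzian_eq (a b c : ℝ) (ha : a ≠ 0) :
      c / a - (3/2) * (b / a) ^ 2 = (c * a - (3/2) * b ^ 2) / a ^ 2 := by
    field_simp
  rw [schwarzian_eq _ _ _ hg]
  refine div_neg_of_neg_of_pos ?_ (by positivity)
  rw [deriv_deriv_deriv_g, deriv_deriv_g, deriv_g]
  ring_nf
  have h2 := pow_nonneg hx 2
  have h3 := pow_nonneg hx 3
  have h4 := pow_nonneg hx 4
  linarith
end

section
/- The orbit of the critical point of g converges to the period-4 orbit: letting c be the unique point in (0, b) with g'(c) = 0, the distance from gⁿ(c) to the set {p, g(p), g²(p), g³(p)} tends to 0 as n → ∞. -/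
open Set Filter

/-- The derivative of `g`. -/
noncomputable def gDeriv (x : ℝ) : ℝ :=
  5 / 2 - x / 5 - 3 * x ^ 2 / 50 - x ^ 3 / 500

theorem hasDerivAt_g (x : ℝ) : HasDerivAt g (gDeriv x) x := by
  have h := ((((hasDerivAt_id x).const_mul (5 / 2 : ℝ)).sub
    (((hasDerivAt_id x).pow 2).div_const 10)).sub
    (((hasDerivAt_id x).pow 3).div_const 50)).sub (((hasDerivAt_id x).pow 4).div_const 2000)
  refine h.congr_deriv ?_
  simp only [gDeriv, id]
  norm_num
  ring

theorem gDeriv_strictAntiOn : StrictAntiOn gDeriv (Ici 0) := by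
  intro x hx y hy hxy
  have hx : 0 ≤ x := hx
  have h2 : x ^ 2 < y ^ 2 := by gcongr
  have h3 : x ^ 3 < y ^ 3 := by gcongr
  unfold gDeriv
  linarith

/-- Two-sided mean value inequality for `g`, whose derivative is decreasing. -/
theorem g_sub_mem {l u x y : ℝ} (hl : 0 ≤ l) (hx : l ≤ x) (hxy : x ≤ y) (hy : y ≤ u) :
    gDeriv u * (y - x) ≤ g y - g x ∧ g y - g x ≤ gDeriv l * (y - x) := by
  have hdiff : Differentiable ℝ g := fun z => (hasDerivAt_g z).differentiableAt
  have hanti := gDeriv_strictAntiOn.antitoneOn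
  have hl' : l ∈ Ici (0 : ℝ) := hl
  have hu' : u ∈ Ici (0 : ℝ) := hl.trans (hx.trans (hxy.trans hy))
  constructor
  · refine (convex_Icc x y).mul_sub_le_image_sub_of_le_deriv hdiff.continuous.continuousOn
      hdiff.differentiableOn (fun z hz => ?_) x ⟨le_rfl, hxy⟩ y ⟨hxy, le_rfl⟩ hxy
    rw [interior_Icc] at hz
    rw [(hasDerivAt_g z).deriv]
    exact hanti (hl.trans (hx.trans hz.1.le)) hu' (hz.2.le.trans hy)
  · refine (convex_Icc x y).image_sub_le_mul_sub_of_deriv_le hdiff.continuous.continuousOn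
      hdiff.differentiableOn (fun z hz => ?_) x ⟨le_rfl, hxy⟩ y ⟨hxy, le_rfl⟩ hxy
    rw [interior_Icc] at hz
    rw [(hasDerivAt_g z).deriv]
    exact hanti hl' (hl.trans (hx.trans hz.1.le)) (hx.trans hz.1.le)

theorem abs_g_sub_le {l u K x y : ℝ} (hl : 0 ≤ l) (hu : -K ≤ gDeriv u) (hK : gDeriv l ≤ K)
    (hx : x ∈ Icc l u) (hy : y ∈ Icc l u) : |g x - g y| ≤ K * |x - y| := by
  wlog hxy : x ≤ y generalizing x y
  · rw [abs_sub_comm, abs_sub_comm x]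
    exact this hy hx (le_of_not_ge hxy)
  obtain ⟨h₁, h₂⟩ := g_sub_mem hl hx.1 hxy hy.2
  have hnn : 0 ≤ y - x := sub_nonneg.2 hxy
  rw [abs_sub_comm, abs_sub_comm x, abs_of_nonneg hnn, abs_le]
  have := mul_le_mul_of_nonneg_right hu hnn
  have := mul_le_mul_of_nonneg_right hK hnn
  constructor <;> linarith

theorem mapsTo_g_of_gDeriv_nonneg {l u : ℝ} (hl : 0 ≤ l) (hu : 0 ≤ gDeriv u) :
    MapsTo g (Icc l u) (Icc (g l) (g u)) := by
  intro x hx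
  have h₁ := (g_sub_mem hl le_rfl hx.1 hx.2).1
  have h₂ := (g_sub_mem hl hx.1 hx.2 le_rfl).1
  have := mul_nonneg hu (sub_nonneg.2 hx.1)
  have := mul_nonneg hu (sub_nonneg.2 hx.2)
  constructor <;> linarith

theorem mapsTo_g_of_gDeriv_nonpos {l u : ℝ} (hl : 0 ≤ l) (hl' : gDeriv l ≤ 0) :
    MapsTo g (Icc l u) (Icc (g u) (g l)) := by
  intro x hx
  have h₁ := (g_sub_mem hl le_rfl hx.1 hx.2).2
  have h₂ := (g_sub_mem hl hx.1 hx.2 le_rfl).2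
  have := mul_nonpos_of_nonpos_of_nonneg hl' (sub_nonneg.2 hx.1)
  have := mul_nonpos_of_nonpos_of_nonneg hl' (sub_nonneg.2 hx.2)
  constructor <;> linarith

/-- An interval around the critical point which `g^[4]` maps into itself. -/
def trap : Set ℝ := Icc 4.51 4.731

theorem mapsTo_g_trap : MapsTo g trap (Icc 7.198 7.2215) := by
  intro x hx
  have h₁ := (g_sub_mem (by norm_num) le_rfl hx.1 hx.2).1
  have h₂ := (g_sub_mem (by norm_num) hx.1 hx.2 le_rfl).1
  obtain ⟨hx₁, hx₂⟩ := hx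
  norm_num [g, gDeriv] at h₁ h₂ hx₁ hx₂ ⊢
  constructor <;> linarith

theorem mapsTo_g_second : MapsTo g (Icc 7.198 7.2215) (Icc 3.946 4.0135) :=
  (mapsTo_g_of_gDeriv_nonpos (by norm_num) (by norm_num [gDeriv])).mono_right
    (Icc_subset_Icc (by norm_num [g]) (by norm_num [g]))

theorem mapsTo_g_third : MapsTo g (Icc 3.946 4.0135) (Icc 6.957 7.001) :=
  (mapsTo_g_of_gDeriv_nonneg (by norm_num) (by norm_num [gDeriv])).mono_right
    (Icc_subset_Icc (by norm_num [g]) (by norm_num [g]))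

theorem mapsTo_g_fourth : MapsTo g (Icc 6.957 7.001) trap :=
  (mapsTo_g_of_gDeriv_nonpos (by norm_num) (by norm_num [gDeriv])).mono_right
    (Icc_subset_Icc (by norm_num [g]) (by norm_num [g]))

theorem mapsTo_iterate_four_trap : MapsTo g^[4] trap trap :=
  fun _ hx => mapsTo_g_fourth (mapsTo_g_third (mapsTo_g_second (mapsTo_g_trap hx)))

theorem abs_iterate_four_sub_le {x y : ℝ} (hx : x ∈ trap) (hy : y ∈ trap) :
    |g^[4] x - g^[4] y| ≤ 0.92 * |x - y| := by
  have hx₁ := mapsTo_g_trap hx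
  have hy₁ := mapsTo_g_trap hy
  have hx₂ := mapsTo_g_second hx₁
  have hy₂ := mapsTo_g_second hy₁
  have h₁ := abs_g_sub_le (K := 0.195) (by norm_num) (by norm_num [gDeriv])
    (by norm_num [gDeriv]) hx hy
  have h₂ := abs_g_sub_le (K := 2.827) (by norm_num) (by norm_num [gDeriv])
    (by norm_num [gDeriv]) hx₁ hy₁
  have h₃ := abs_g_sub_le (K := 0.654) (by norm_num) (by norm_num [gDeriv])
    (by norm_num [gDeriv]) hx₂ hy₂
  have h₄ := abs_g_sub_le (K := 2.53) (by norm_num) (by norm_num [gDeriv])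
    (by norm_num [gDeriv]) (mapsTo_g_third hx₂) (mapsTo_g_third hy₂)
  change |g (g (g (g x))) - g (g (g (g y)))| ≤ _
  linarith [abs_nonneg (x - y)]

theorem tendsto_iterate_four {x p : ℝ} (hx : x ∈ trap) (hp : p ∈ trap) (hper : g^[4] p = p) :
    Tendsto (fun k => g^[4 * k] x) atTop (nhds p) := by
  have key : ∀ k, g^[4 * k] x ∈ trap ∧ |g^[4 * k] x - p| ≤ 0.92 ^ k * |x - p| := by
    intro k
    induction k with
    | zero => simpa using hx
    | succ k ih =>
      have hk : g^[4 * (k + 1)] x = g^[4] (g^[4 * k] x) := by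
        rw [← Function.iterate_add_apply, mul_add, mul_one, add_comm]
      rw [hk]
      refine ⟨mapsTo_iterate_four_trap ih.1, ?_⟩
      have h := abs_iterate_four_sub_le ih.1 hp
      rw [hper] at h
      rw [pow_succ]
      linarith [ih.2]
  rw [tendsto_iff_dist_tendsto_zero]
  refine squeeze_zero (fun _ => dist_nonneg) (fun k => (key k).2) ?_
  simpa using (tendsto_pow_atTop_nhds_zero_of_lt_one (r := (0.92 : ℝ))
    (by norm_num) (by norm_num)).mul_const |x - p|

theorem mem_trap_of_gDeriv_eq_zero {c : ℝ} (hc : 0 ≤ c) (h : gDeriv c = 0) : c ∈ trap := by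
  constructor <;> by_contra! hlt
  · have := gDeriv_strictAntiOn hc (mem_Ici.2 (by norm_num)) hlt
    norm_num [h] at this
    norm_num [gDeriv] at this
  · have := gDeriv_strictAntiOn (mem_Ici.2 (by norm_num)) hc hlt
    norm_num [h] at this
    norm_num [gDeriv] at this

theorem critical_orbit_converges_to_period_four
    (b : ℝ) (hb_pos : 0 < b) (hb_root : g b = 0)
    (hb_unique : ∀ y : ℝ, 0 < y → g y = 0 → y = b)
    (c : ℝ) (hc : c ∈ Set.Ioo (0 : ℝ) b) (hc_crit : deriv g c = 0)
    (hc_unique : ∀ c' ∈ Set.Ioo (0 : ℝ) b, deriv g c' = 0 → c' = c)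
    (p : ℝ) (hp : |p - 4.613677692731402| < 1/10) (hper : g^[4] p = p)
    (h1 : |g p - 7.214907799688287| < 1/10)
    (h2 : |g^[2] p - 3.9654987245283035| < 1/10)
    (h3 : |g^[3] p - 6.9704245174643379| < 1/10) :
    Filter.Tendsto
      (fun n : ℕ => Metric.infDist (g^[n] c) {p, g p, g^[2] p, g^[3] p})
      Filter.atTop (nhds 0) := by
  have hcont : Continuous g :=
    continuous_iff_continuousAt.2 fun x => (hasDerivAt_g x).continuousAt
  have hc_trap : c ∈ trap :=
    mem_trap_of_gDeriv_eq_zero hc.1.le ((hasDerivAt_g c).deriv ▸ hc_crit)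
  have hp_trap : p ∈ trap := by
    rw [abs_lt] at hp
    norm_num [trap] at hp ⊢
    constructor <;> linarith
  have hlim := tendsto_iterate_four hc_trap hp_trap hper
  have hmod (r : ℕ) (hr : g^[r] p ∈ ({p, g p, g^[2] p, g^[3] p} : Set ℝ)) :
      Tendsto (fun k => Metric.infDist (g^[4 * k + r] c) {p, g p, g^[2] p, g^[3] p})
        atTop (nhds 0) := by
    have h := ((hcont.iterate r).tendsto p).comp hlim
    rw [tendsto_iff_dist_tendsto_zero] at h
    refine squeeze_zero (fun _ => Metric.infDist_nonneg) (fun k => ?_) h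
    rw [add_comm, Function.iterate_add_apply]
    exact Metric.infDist_le_dist_of_mem hr
  have h₀ := hmod 0 (by simp)
  have h₁ := hmod 1 (by simp)
  have h₂ := hmod 2 (by simp)
  have h₃ := hmod 3 (by simp)
  rw [Metric.tendsto_atTop] at h₀ h₁ h₂ h₃ ⊢
  intro ε hε
  obtain ⟨N₀, h₀⟩ := h₀ ε hε
  obtain ⟨N₁, h₁⟩ := h₁ ε hε
  obtain ⟨N₂, h₂⟩ := h₂ ε hε
  obtain ⟨N₃, h₃⟩ := h₃ ε hε
  refine ⟨4 * (N₀ + N₁ + N₂ + N₃), fun n hn => ?_⟩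
  have hn' := Nat.div_add_mod n 4
  have hr : n % 4 < 4 := Nat.mod_lt _ (by norm_num)
  rw [← hn']
  generalize n % 4 = r at hn' hr ⊢
  interval_cases r
  · exact h₀ _ (by lia)
  · exact h₁ _ (by lia)
  · exact h₂ _ (by lia)
  · exact h₃ _ (by lia)
end
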